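/- arXiv:2201.03249 — 6 statements merged into one kernel-verified Lean document; each statement's English description precedes it below -/
import Mathlib

section
/- Let ℏ ∈ ℝ with ℏ ≤ 0. Then for every finitely supported function v : ℕ → ℂ, the sum Σ_{i,j ∈ ℕ} conj(v_i) · e^{−ijℏ} · v_j is a nonnegative real number; that is, the infinite matrix (e^{−ijℏ})_{i,j ∈ ℕ} is positive semidefinite. -/
open scoped ComplexOrder

/-- For `ℏ ≤ 0`, the infinite matrix `(e^{−ijℏ})_{i,j ∈ ℕ}` is positive semidefinite:
for every finitely supported `v : ℕ → ℂ`, the sum `Σ_{i,j} conj(v_i) e^{−ijℏ} v_j` is a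
nonnegative real number (expressed via the order on `ℂ`, where `0 ≤ z` means `z` is a
nonnegative real). -/
theorem vandermonde_matrix_posSemidef (ℏ : ℝ) (hℏ : ℏ ≤ 0) (v : ℕ →₀ ℂ) :
    0 ≤ ∑ i ∈ v.support, ∑ j ∈ v.support,
        (starRingEnd ℂ) (v i) * (Real.exp (-((i : ℝ) * (j : ℝ) * ℏ)) : ℂ) * v j := by
  have h1 : ∀ x : ℝ, HasSum (fun n : ℕ => ((x ^ n / (n.factorial : ℝ) : ℝ) : ℂ))
      ((Real.exp x : ℝ) : ℂ) := by
    intro x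
    rw [Complex.hasSum_ofReal, Real.exp_eq_exp_ℝ]
    exact NormedSpace.expSeries_div_hasSum_exp x
  have h2 : HasSum (fun n : ℕ => ∑ i ∈ v.support, ∑ j ∈ v.support,
      (starRingEnd ℂ) (v i) *
        (((-((i : ℝ) * (j : ℝ) * ℏ)) ^ n / (n.factorial : ℝ) : ℝ) : ℂ) * v j)
      (∑ i ∈ v.support, ∑ j ∈ v.support,
        (starRingEnd ℂ) (v i) * (Real.exp (-((i : ℝ) * (j : ℝ) * ℏ)) : ℂ) * v j) := by
    refine hasSum_sum fun i _ => hasSum_sum fun j _ => ?_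
    exact ((h1 _).mul_left _).mul_right _
  refine h2.nonneg fun n => ?_
  have h3 : (∑ i ∈ v.support, ∑ j ∈ v.support,
      (starRingEnd ℂ) (v i) *
        (((-((i : ℝ) * (j : ℝ) * ℏ)) ^ n / (n.factorial : ℝ) : ℝ) : ℂ) * v j)
      = (((-ℏ) ^ n / (n.factorial : ℝ) : ℝ) : ℂ) *
        (star (∑ i ∈ v.support, v i * (i : ℂ) ^ n) * (∑ j ∈ v.support, v j * (j : ℂ) ^ n)) := by
    rw [star_sum, Finset.sum_mul_sum, Finset.mul_sum]
    refine Finset.sum_congr rfl fun i _ => ?_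
    rw [Finset.mul_sum]
    refine Finset.sum_congr rfl fun j _ => ?_
    have : (-((i : ℝ) * (j : ℝ) * ℏ)) ^ n = (-ℏ) ^ n * (i : ℝ) ^ n * (j : ℝ) ^ n := by
      rw [← mul_pow, ← mul_pow]; congr 1; ring
    rw [this]
    simp
    ring
  rw [h3]
  refine mul_nonneg ?_ (star_mul_self_nonneg _)
  have : 0 ≤ (-ℏ) ^ n / (n.factorial : ℝ) :=
    div_nonneg (pow_nonneg (by linarith) n) (by positivity)
  exact_mod_cast this
end

section
/- Let ℏ ∈ ℝ with ℏ ≤ 0, let d ≥ 1, and let z ∈ ℂ^d lie in the antidiagonal Λ (i.e. z_i = conj(z_{d+1−i}) for all i). Define the linear functional δ_z^ℏ on ℂ[x_1,…,x_d] by δ_z^ℏ(x^K) = z^K · exp(−½ℏ Σ_{1≤i,j≤d} m_{ij} K_i K_j). Then δ_z^ℏ is positive for the Wick-type product ⋆_ℏ: for every polynomial f, the number δ_z^ℏ(f* ⋆_ℏ f) is a nonnegative real. -/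
open MvPolynomial
open scoped ComplexOrder

/-- The exponent `Σ_{1 ≤ i < j ≤ d} K_j L_i` appearing in the combinatorial star product. -/
def starExp {d : ℕ} (K L : Fin d →₀ ℕ) : ℕ :=
  ∑ p ∈ Finset.univ.filter (fun p : Fin d × Fin d => p.1 < p.2), K p.2 * L p.1

/-- The star involution `f ↦ f*` on `ℂ[x_1,…,x_d]`: conjugate the coefficients and reverse
the variables, `(Σ_K f_K x^K)* = Σ_K conj(f_K) x^{K^∨}` with `K^∨ = (K_d,…,K_1)`. -/
noncomputable def starInv {d : ℕ} (f : MvPolynomial (Fin d) ℂ) : MvPolynomial (Fin d) ℂ :=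
  rename Fin.rev (MvPolynomial.map (starRingEnd ℂ) f)

/-- `m_{ij} = min{i−1, j−1, d−i, d−j}` for `1 ≤ i,j ≤ d`, written with `0`-based indices. -/
def mIdx (d : ℕ) (i j : Fin d) : ℕ :=
  min (min i.1 j.1) (min (d - 1 - i.1) (d - 1 - j.1))

/-- The deformed evaluation functional
`δ_z^ℏ(x^K) = z^K exp(−½ℏ Σ_{1≤i,j≤d} m_{ij} K_i K_j)` (for `ℏ ≤ 0`), extended linearly. -/
noncomputable def deltaNeg {d : ℕ} (ℏ : ℝ) (z : Fin d → ℂ)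
    (f : MvPolynomial (Fin d) ℂ) : ℂ :=
  ∑ K ∈ f.support, f.coeff K * (∏ i, z i ^ K i) *
    (Real.exp (-(ℏ / 2) * ((∑ i : Fin d, ∑ j : Fin d, mIdx d i j * K i * K j : ℕ) : ℝ)) : ℂ)

lemma hasSum_aux (x y : ℝ) (c : ℂ) :
    HasSum (fun n : ℕ => c * (Real.exp y : ℂ) * ((x ^ n / (n.factorial : ℝ) : ℝ) : ℂ))
      (c * (Real.exp (x + y) : ℂ)) := by
  have h : HasSum (fun n : ℕ => x ^ n / (n.factorial : ℝ)) (Real.exp x) := by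
    rw [Real.exp_eq_exp_ℝ]
    exact NormedSpace.expSeries_div_hasSum_exp x
  have h2 := (Complex.hasSum_ofReal.2 h).mul_left (c * (Real.exp y : ℂ))
  have e : c * (Real.exp (x + y) : ℂ) = c * (Real.exp y : ℂ) * (Real.exp x : ℂ) := by
    rw [Real.exp_add, Complex.ofReal_mul]; ring
  rw [e]
  exact h2

lemma kernel_exp_pos {ι : Type*} (s : Finset ι) (S : Finset ℕ) (t : ℝ) (ht : 0 ≤ t)
    (W : ℕ → ι → ℝ) (c : ι → ℂ) :
    0 ≤ ∑ K ∈ s, ∑ L ∈ s, (starRingEnd ℂ) (c K) * c L *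
      (Real.exp (t * ∑ k ∈ S, W k K * W k L) : ℂ) := by
  induction S using Finset.induction_on generalizing c with
  | empty =>
    have h : ∑ K ∈ s, ∑ L ∈ s, (starRingEnd ℂ) (c K) * c L *
      (Real.exp (t * ∑ k ∈ (∅ : Finset ℕ), W k K * W k L) : ℂ)
        = star (∑ K ∈ s, c K) * (∑ K ∈ s, c K) := by
      simp [Finset.sum_mul_sum]
    rw [h]
    exact star_mul_self_nonneg _
  | insert a S ha ih =>
    have key : HasSum (fun n : ℕ => ∑ K ∈ s, ∑ L ∈ s, (starRingEnd ℂ) (c K) * c L *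
      (Real.exp (t * ∑ k ∈ S, W k K * W k L) : ℂ) *
        (((t * (W a K * W a L)) ^ n / (n.factorial : ℝ) : ℝ) : ℂ))
      (∑ K ∈ s, ∑ L ∈ s, (starRingEnd ℂ) (c K) * c L *
      (Real.exp (t * ∑ k ∈ insert a S, W k K * W k L) : ℂ)) := by
      refine hasSum_sum fun K _ => hasSum_sum fun L _ => ?_
      rw [Finset.sum_insert ha, mul_add]
      exact hasSum_aux _ _ _
    refine key.nonneg fun n => ?_
    have h := ih (fun K => c K * ((W a K ^ n : ℝ) : ℂ))
    have h2 : (0 : ℂ) ≤ ((t ^ n / (n.factorial : ℝ) : ℝ) : ℂ) := by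
      rw [Complex.zero_le_real]; positivity
    refine (mul_nonneg h2 h).trans_eq ?_
    rw [Finset.mul_sum]
    refine Finset.sum_congr rfl fun K _ => ?_
    rw [Finset.mul_sum]
    refine Finset.sum_congr rfl fun L _ => ?_
    simp only [map_mul, Complex.conj_ofReal]
    push_cast
    rw [mul_pow, mul_pow]
    ring

lemma count_eq (d : ℕ) (a i : Fin d) :
    (if i < Fin.rev a then 1 else 0) + mIdx d a i
      = ∑ k ∈ Finset.range d, (if k ≤ a.1 ∧ a.1 + k + 2 ≤ d then 1 else 0) *
          (if k ≤ i.1 ∧ i.1 + k + 2 ≤ d then 1 else 0) := by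
  have h : ∀ k, (if k ≤ a.1 ∧ a.1 + k + 2 ≤ d then 1 else 0) *
          (if k ≤ i.1 ∧ i.1 + k + 2 ≤ d then 1 else 0)
      = if k < min (min (a.1+1) (i.1+1)) (min (d-1-a.1) (d-1-i.1)) then 1 else 0 := by
    intro k
    have := a.2
    have := i.2
    split_ifs <;> first | rfl | omega
  simp only [h]
  rw [← Finset.sum_filter, Finset.sum_const, smul_eq_mul, mul_one]
  have h3 : (Finset.range d).filter
      (fun k => k < min (min (a.1+1) (i.1+1)) (min (d-1-a.1) (d-1-i.1)))
      = Finset.range (min (min (a.1+1) (i.1+1)) (min (d-1-a.1) (d-1-i.1))) := by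
    ext k
    simp only [Finset.mem_filter, Finset.mem_range]
    omega
  rw [h3, Finset.card_range, mIdx]
  simp only [Fin.lt_def, Fin.val_rev]
  have := a.2
  have := i.2
  split_ifs <;> omega

lemma mIdx_rev_left (d : ℕ) (i j : Fin d) : mIdx d (Fin.rev i) j = mIdx d i j := by
  simp only [mIdx, Fin.val_rev]; omega

lemma mIdx_rev_right (d : ℕ) (i j : Fin d) : mIdx d i (Fin.rev j) = mIdx d i j := by
  simp only [mIdx, Fin.val_rev]; omega

lemma mIdx_comm (d : ℕ) (i j : Fin d) : mIdx d i j = mIdx d j i := by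
  simp only [mIdx]; omega

def qF {d : ℕ} (K : Fin d →₀ ℕ) : ℕ := ∑ i : Fin d, ∑ j : Fin d, mIdx d i j * K i * K j

noncomputable def revF {d : ℕ} (K : Fin d →₀ ℕ) : Fin d →₀ ℕ := Finsupp.mapDomain Fin.rev K

lemma revF_apply {d : ℕ} (K : Fin d →₀ ℕ) (i : Fin d) : revF K i = K (Fin.rev i) := by
  have := Finsupp.mapDomain_apply (Fin.rev_injective) K (Fin.rev i)
  rwa [Fin.rev_rev] at this

lemma qF_revF_add {d : ℕ} (K L : Fin d →₀ ℕ) :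
    qF (revF K + L) = qF K + qF L + 2 * ∑ i, ∑ j, mIdx d i j * K i * L j := by
  have h1 : ∑ i : Fin d, ∑ j : Fin d, mIdx d i j * revF K i * revF K j = qF K := by
    rw [← Equiv.sum_comp Fin.revPerm]
    refine Finset.sum_congr rfl fun i _ => ?_
    rw [← Equiv.sum_comp Fin.revPerm]
    simp [revF_apply, mIdx_rev_left, mIdx_rev_right]
  have h2 : ∑ i : Fin d, ∑ j : Fin d, mIdx d i j * revF K i * L j
      = ∑ i, ∑ j, mIdx d i j * K i * L j := by
    rw [← Equiv.sum_comp Fin.revPerm]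
    simp [revF_apply, mIdx_rev_left]
  have h3 : ∑ i : Fin d, ∑ j : Fin d, mIdx d i j * L i * revF K j
      = ∑ i, ∑ j, mIdx d i j * K i * L j := by
    rw [← h2, Finset.sum_comm]
    refine Finset.sum_congr rfl fun i _ => Finset.sum_congr rfl fun j _ => ?_
    rw [mIdx_comm]; ring
  rw [two_mul, ← h1]
  nth_rw 1 [← h2]
  rw [← h3]
  simp only [qF, ← Finset.sum_add_distrib]
  refine Finset.sum_congr rfl fun i _ => Finset.sum_congr rfl fun j _ => ?_
  simp only [Finsupp.add_apply]
  ring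

lemma starExp_revF {d : ℕ} (K L : Fin d →₀ ℕ) :
    starExp (revF K) L = ∑ a, ∑ i, (if i < Fin.rev a then 1 else 0) * K a * L i := by
  rw [starExp, Finset.sum_filter, Fintype.sum_prod_type, Finset.sum_comm,
    ← Equiv.sum_comp Fin.revPerm]
  refine Finset.sum_congr rfl fun a _ => Finset.sum_congr rfl fun i _ => ?_
  simp [revF_apply]

def wF {d : ℕ} (k : ℕ) (K : Fin d →₀ ℕ) : ℕ :=
  ∑ a : Fin d, (if k ≤ a.1 ∧ a.1 + k + 2 ≤ d then 1 else 0) * K a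

lemma exp_id {d : ℕ} (K L : Fin d →₀ ℕ) :
    2 * starExp (revF K) L + qF (revF K + L)
      = qF K + qF L + 2 * ∑ k ∈ Finset.range d, wF k K * wF k L := by
  have : ∑ k ∈ Finset.range d, wF k K * wF k L
      = starExp (revF K) L + ∑ i, ∑ j, mIdx d i j * K i * L j := by
    rw [starExp_revF]
    simp only [wF, Finset.sum_mul_sum, ← Finset.sum_add_distrib]
    rw [Finset.sum_comm]
    refine Finset.sum_congr rfl fun a _ => ?_
    rw [Finset.sum_comm]
    refine Finset.sum_congr rfl fun i _ => ?_
    rw [← add_mul, ← add_mul, count_eq, Finset.sum_mul, Finset.sum_mul]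
    refine Finset.sum_congr rfl fun k _ => ?_
    ring
  rw [this, qF_revF_add]; ring

noncomputable def phiF {d : ℕ} (ℏ : ℝ) (z : Fin d → ℂ) (K : Fin d →₀ ℕ) : ℂ :=
  (∏ i, z i ^ K i) * (Real.exp (-(ℏ / 2) * (qF K : ℝ)) : ℂ)

lemma deltaNeg_eq {d : ℕ} (ℏ : ℝ) (z : Fin d → ℂ) (f : MvPolynomial (Fin d) ℂ) :
    deltaNeg ℏ z f = (basisMonomials (Fin d) ℂ).constr ℂ (phiF ℏ z) f := by
  rw [Module.Basis.constr_apply, deltaNeg]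
  have : ∀ K, f.coeff K * (∏ i, z i ^ K i) *
    (Real.exp (-(ℏ / 2) * ((∑ i : Fin d, ∑ j : Fin d, mIdx d i j * K i * K j : ℕ) : ℝ)) : ℂ)
      = f.coeff K • phiF ℏ z K := fun K => by rw [mul_assoc]; rfl
  simp only [this]
  rfl

theorem deltaNeg_positive {d : ℕ} (hd : 1 ≤ d) (ℏ : ℝ) (hℏ : ℏ ≤ 0) (z : Fin d → ℂ)
    (hz : ∀ i, z i = (starRingEnd ℂ) (z (Fin.rev i)))
    (B : MvPolynomial (Fin d) ℂ →ₗ[ℂ] MvPolynomial (Fin d) ℂ →ₗ[ℂ] MvPolynomial (Fin d) ℂ)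
    (hB : ∀ K L : Fin d →₀ ℕ,
      B (monomial K 1) (monomial L 1)
        = (Real.exp (-(ℏ * (starExp K L : ℝ))) : ℂ) • monomial (K + L) (1 : ℂ))
    (f : MvPolynomial (Fin d) ℂ) :
    0 ≤ deltaNeg ℏ z (B (starInv f) f) := by
  rw [deltaNeg_eq]
  set D := (basisMonomials (Fin d) ℂ).constr ℂ (phiF ℏ z) with hD
  have hDm : ∀ K, D (monomial K 1) = phiF ℏ z K := by
    intro K
    have := (basisMonomials (Fin d) ℂ).constr_basis ℂ (phiF ℏ z) K
    rwa [coe_basisMonomials] at this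
  have hf : f = ∑ L ∈ f.support, f.coeff L • monomial L (1 : ℂ) := by
    conv_lhs => rw [f.as_sum]
    simp [smul_monomial]
  have hs : starInv f = ∑ K ∈ f.support,
      (starRingEnd ℂ) (f.coeff K) • monomial (revF K) (1 : ℂ) := by
    conv_lhs => rw [f.as_sum]
    simp only [starInv, map_sum, map_monomial, rename_monomial, smul_monomial, revF, smul_eq_mul,
      mul_one]
  have e : D (B (starInv f) f) = ∑ K ∈ f.support, ∑ L ∈ f.support,
      (starRingEnd ℂ) (f.coeff K) * f.coeff L *
        (Real.exp (-(ℏ * (starExp (revF K) L : ℝ))) * phiF ℏ z (revF K + L)) := by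
    conv_lhs => rw [hs]
    conv_lhs => enter [2, 2]; rw [hf]
    simp only [map_sum, LinearMap.sum_apply, map_smul, LinearMap.smul_apply, hB, hDm, smul_eq_mul,
      Finset.mul_sum]
    rw [Finset.sum_comm]
    refine Finset.sum_congr rfl fun K _ => Finset.sum_congr rfl fun L _ => ?_
    ring
  rw [e]
  have := kernel_exp_pos f.support (Finset.range d) (-ℏ) (by linarith)
    (fun k K => (wF k K : ℝ)) (fun K => f.coeff K * phiF ℏ z K)
  refine this.trans_eq ?_
  refine Finset.sum_congr rfl fun K _ => Finset.sum_congr rfl fun L _ => ?_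
  have hzK : ∏ i, z i ^ (revF K + L) i
      = (starRingEnd ℂ) (∏ i, z i ^ K i) * ∏ i, z i ^ L i := by
    simp only [Finsupp.add_apply, pow_add, Finset.prod_mul_distrib]
    congr 1
    rw [← Equiv.prod_comp Fin.revPerm, map_prod]
    refine Finset.prod_congr rfl fun i _ => ?_
    rw [Fin.revPerm_apply, revF_apply, Fin.rev_rev, map_pow, hz (Fin.rev i), Fin.rev_rev]
  have hE : Real.exp (-(ℏ / 2) * (qF K : ℝ)) * Real.exp (-(ℏ / 2) * (qF L : ℝ)) *
      Real.exp (-ℏ * ∑ k ∈ Finset.range d, (wF k K : ℝ) * (wF k L : ℝ))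
      = Real.exp (-(ℏ * (starExp (revF K) L : ℝ))) *
        Real.exp (-(ℏ / 2) * (qF (revF K + L) : ℝ)) := by
    rw [← Real.exp_add, ← Real.exp_add, ← Real.exp_add]
    congr 1
    have h : (2 * starExp (revF K) L + qF (revF K + L) : ℝ)
      = qF K + qF L + 2 * ∑ k ∈ Finset.range d, (wF k K : ℝ) * wF k L := by
      exact_mod_cast exp_id K L
    linear_combination (ℏ / 2) * h
  have hE' := congrArg (fun x : ℝ => (x : ℂ)) hE
  simp only [Complex.ofReal_mul] at hE'
  simp only [phiF, map_mul, Complex.conj_ofReal]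
  rw [hzK]
  linear_combination (starRingEnd ℂ) (f.coeff K) * f.coeff L *
    ((starRingEnd ℂ) (∏ i, z i ^ K i) * ∏ i, z i ^ L i) * hE'
end

section
/- Let ℏ ∈ ℝ and d ≥ 1. Let Ψ_ℏ be the ℂ-linear map on ℂ[x_1,…,x_d] determined by Ψ_ℏ(x^K) = e^{ℏ Σ_{1≤i<j≤d} K_i K_j} x^{K^∨}. Then Ψ_ℏ is a bijective linear map intertwining the Wick-type products and the star involution: Ψ_ℏ(f ⋆_ℏ g) = Ψ_ℏ(f) ⋆_{−ℏ} Ψ_ℏ(g) and Ψ_ℏ(f*) = (Ψ_ℏ f)* for all polynomials f, g; that is, Ψ_ℏ is a *-isomorphism from (ℂ[x_1,…,x_d], ⋆_ℏ, *) onto (ℂ[x_1,…,x_d], ⋆_{−ℏ}, *). -/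
open MvPolynomial

/-- The reversed multi-index `K^∨ = (K_d, …, K_1)`. -/
noncomputable def revIdx {d : ℕ} (K : Fin d →₀ ℕ) : Fin d →₀ ℕ :=
  Finsupp.mapDomain Fin.rev K

theorem revIdx_apply' {d : ℕ} (K : Fin d →₀ ℕ) (i : Fin d) : revIdx K i = K i.rev := by
  have h := Finsupp.mapDomain_apply (Fin.rev_injective (n := d)) K i.rev
  rw [Fin.rev_rev] at h
  exact h

theorem revIdx_revIdx {d : ℕ} (K : Fin d →₀ ℕ) : revIdx (revIdx K) = K := by
  ext i; simp [revIdx_apply']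

theorem revIdx_add {d : ℕ} (K L : Fin d →₀ ℕ) : revIdx (K + L) = revIdx K + revIdx L := by
  ext i; simp [revIdx_apply']

theorem starExp_rev {d : ℕ} (K L : Fin d →₀ ℕ) :
    starExp (revIdx K) (revIdx L) = starExp L K := by
  unfold starExp
  refine Finset.sum_bij' (fun p _ => (p.2.rev, p.1.rev)) (fun p _ => (p.2.rev, p.1.rev))
    ?_ ?_ ?_ ?_ ?_ <;> simp [revIdx_apply', mul_comm]

theorem starExp_add {d : ℕ} (K L : Fin d →₀ ℕ) :
    starExp (K + L) (K + L) = starExp K K + starExp L L + starExp K L + starExp L K := by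
  unfold starExp
  simp only [← Finset.sum_add_distrib]
  refine Finset.sum_congr rfl fun p _ => ?_
  simp only [Finsupp.add_apply]
  ring

theorem mono_eq_smul {d : ℕ} (K : Fin d →₀ ℕ) (c : ℂ) :
    monomial K c = c • monomial K (1 : ℂ) := by
  simp [smul_monomial]

theorem starInv_mono {d : ℕ} (K : Fin d →₀ ℕ) (c : ℂ) :
    starInv (monomial K c) = (starRingEnd ℂ c) • monomial (revIdx K) (1 : ℂ) := by
  simp [starInv, map_monomial, rename_monomial, revIdx, smul_monomial]

theorem starInv_add {d : ℕ} (f g : MvPolynomial (Fin d) ℂ) :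
    starInv (f + g) = starInv f + starInv g := by
  simp [starInv]

/-- The linear map `Ψ_ℏ` determined by `Ψ_ℏ(x^K) = e^{ℏ Σ_{i<j} K_i K_j} x^{K^∨}` is a
`*`-isomorphism from `(ℂ[x_1,…,x_d], ⋆_ℏ, *)` onto `(ℂ[x_1,…,x_d], ⋆_{−ℏ}, *)`: it is
bijective, intertwines the Wick-type products `⋆_ℏ` and `⋆_{−ℏ}`, and commutes with the
star involution. -/
theorem psi_star_isomorphism {d : ℕ} (hd : 1 ≤ d) (ℏ : ℝ)
    (Ψ : MvPolynomial (Fin d) ℂ →ₗ[ℂ] MvPolynomial (Fin d) ℂ)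
    (hΨ : ∀ K : Fin d →₀ ℕ, Ψ (monomial K 1)
      = (Real.exp (ℏ * (starExp K K : ℝ)) : ℂ) • monomial (revIdx K) (1 : ℂ))
    (B₁ B₂ : MvPolynomial (Fin d) ℂ →ₗ[ℂ] MvPolynomial (Fin d) ℂ →ₗ[ℂ] MvPolynomial (Fin d) ℂ)
    (hB₁ : ∀ K L : Fin d →₀ ℕ, B₁ (monomial K 1) (monomial L 1)
      = (Real.exp (-(ℏ * (starExp K L : ℝ))) : ℂ) • monomial (K + L) (1 : ℂ))
    (hB₂ : ∀ K L : Fin d →₀ ℕ, B₂ (monomial K 1) (monomial L 1)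
      = (Real.exp (ℏ * (starExp K L : ℝ)) : ℂ) • monomial (K + L) (1 : ℂ)) :
    Function.Bijective Ψ ∧
    (∀ f g : MvPolynomial (Fin d) ℂ, Ψ (B₁ f g) = B₂ (Ψ f) (Ψ g)) ∧
    (∀ f : MvPolynomial (Fin d) ℂ, Ψ (starInv f) = starInv (Ψ f)) := by
  refine ⟨?_, ?_, ?_⟩
  · let Φ : MvPolynomial (Fin d) ℂ →ₗ[ℂ] MvPolynomial (Fin d) ℂ :=
      (basisMonomials (Fin d) ℂ).constr ℂ fun K =>
        (Real.exp (-(ℏ * (starExp K K : ℝ))) : ℂ) • monomial (revIdx K) (1 : ℂ)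
    have hΦ : ∀ K : Fin d →₀ ℕ, Φ (monomial K 1) =
        (Real.exp (-(ℏ * (starExp K K : ℝ))) : ℂ) • monomial (revIdx K) (1 : ℂ) := by
      intro K
      have := (basisMonomials (Fin d) ℂ).constr_basis ℂ (fun K =>
        (Real.exp (-(ℏ * (starExp K K : ℝ))) : ℂ) • monomial (revIdx K) (1 : ℂ)) K
      simpa only [coe_basisMonomials] using this
    have h1 : Φ ∘ₗ Ψ = LinearMap.id := by
      refine (basisMonomials (Fin d) ℂ).ext fun K => ?_
      simp only [coe_basisMonomials, LinearMap.comp_apply, LinearMap.id_apply, hΨ, map_smul, hΦ,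
        smul_smul, revIdx_revIdx, starExp_rev]
      rw [← Complex.ofReal_mul, ← Real.exp_add]
      simp
    have h2 : Ψ ∘ₗ Φ = LinearMap.id := by
      refine (basisMonomials (Fin d) ℂ).ext fun K => ?_
      simp only [coe_basisMonomials, LinearMap.comp_apply, LinearMap.id_apply, hΨ, map_smul, hΦ,
        smul_smul, revIdx_revIdx, starExp_rev]
      rw [← Complex.ofReal_mul, ← Real.exp_add]
      simp
    exact Function.bijective_iff_has_inverse.2
      ⟨Φ, fun x => LinearMap.congr_fun h1 x, fun x => LinearMap.congr_fun h2 x⟩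
  · intro f g
    induction f using MvPolynomial.induction_on' with
    | add p q hp hq => simp only [map_add, LinearMap.add_apply, hp, hq]
    | monomial K a =>
      induction g using MvPolynomial.induction_on' with
      | add p q hp hq => simp only [map_add, hp, hq]
      | monomial L b =>
        rw [mono_eq_smul K a, mono_eq_smul L b]
        simp only [map_smul, LinearMap.smul_apply, hΨ, hB₁, hB₂, revIdx_add, starExp_rev,
          smul_smul, starExp_add]
        congr 1
        simp only [mul_assoc, ← Complex.ofReal_mul, ← Real.exp_add]
        rw [mul_left_comm (Complex.ofReal _) a]
        simp only [← Complex.ofReal_mul, ← Real.exp_add]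
        push_cast
        ring_nf
  · intro f
    induction f using MvPolynomial.induction_on' with
    | add p q hp hq => simp only [map_add, starInv_add, hp, hq]
    | monomial K a =>
      rw [starInv_mono, mono_eq_smul K a]
      simp only [map_smul, hΨ, smul_smul, starExp_rev, revIdx_revIdx]
      rw [← mono_eq_smul, ← mono_eq_smul, starInv_mono, revIdx_revIdx, ← mono_eq_smul, map_mul (starRingEnd ℂ),
        Complex.conj_ofReal]
end

section
/- Fix d ≥ 1 and let q ∈ ℂ with [k]_q ≠ 0 for all k ≥ 1. Then the symmetrized combinatorial star product ⋆̃_q on ℂ[x_1,…,x_d], the unique ℂ-bilinear map with x^K ⋆̃_q x^L = (multinomial(K+L)/(multinomial(K)·multinomial(L))) · (binom_q(K)·binom_q(L)/binom_q(K+L)) · q^{Σ_{1≤i<j≤d} K_j L_i} · x^{K+L}, is associative. (It is the conjugate of the log-canonical combinatorial star product ⋆_q under the invertible linear map T mapping x^K ↦ (binom_q(K)/multinomial(K)) x^K: f ⋆̃_q g = T^{−1}(T f ⋆_q T g).) -/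
open MvPolynomial

/-- The `q`-number `[k]_q = 1 + q + ⋯ + q^{k−1}`. -/
noncomputable def qNat (q : ℂ) (k : ℕ) : ℂ := ∑ i ∈ Finset.range k, q ^ i

/-- The `q`-factorial `[k]_q! = [k]_q [k−1]_q ⋯ [1]_q`, with `[0]_q! = 1`. -/
noncomputable def qFactorial (q : ℂ) : ℕ → ℂ
  | 0 => 1
  | k + 1 => qNat q (k + 1) * qFactorial q k

/-- The `q`-multinomial coefficient `binom_q(K) = [|K|]_q! / ([K_1]_q! ⋯ [K_d]_q!)`. -/
noncomputable def qMultinomial (q : ℂ) {d : ℕ} (K : Fin d → ℕ) : ℂ :=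
  qFactorial q (∑ i, K i) / ∏ i, qFactorial q (K i)

/-- The exponent `Σ_{1 ≤ i < j ≤ d} K_j L_i`. -/
def starExpF {d : ℕ} (K L : Fin d → ℕ) : ℕ :=
  ∑ p ∈ Finset.univ.filter (fun p : Fin d × Fin d => p.1 < p.2), K p.2 * L p.1

/-- The coefficient of the symmetrized combinatorial star product:
`(multinomial(K+L)/(multinomial(K)·multinomial(L))) ·
(binom_q(K)·binom_q(L)/binom_q(K+L)) · q^{Σ_{i<j} K_j L_i}`. -/
noncomputable def symCoeff (q : ℂ) {d : ℕ} (K L : Fin d →₀ ℕ) : ℂ :=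
  ((Nat.multinomial Finset.univ ⇑(K + L) : ℂ) /
      ((Nat.multinomial Finset.univ ⇑K : ℂ) * (Nat.multinomial Finset.univ ⇑L : ℂ)))
    * (qMultinomial q ⇑K * qMultinomial q ⇑L / qMultinomial q ⇑(K + L))
    * q ^ starExpF ⇑K ⇑L

theorem qFactorial_ne_zero_aux (q : ℂ) (hq : ∀ k, 1 ≤ k → qNat q k ≠ 0) (k : ℕ) :
    qFactorial q k ≠ 0 := by
  induction k with
  | zero => simp [qFactorial]
  | succ n ih => exact mul_ne_zero (hq _ (by omega)) ih

theorem qMultinomial_ne_zero_aux (q : ℂ) (hq : ∀ k, 1 ≤ k → qNat q k ≠ 0) {d : ℕ}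
    (K : Fin d → ℕ) : qMultinomial q K ≠ 0 :=
  div_ne_zero (qFactorial_ne_zero_aux q hq _)
    (Finset.prod_ne_zero_iff.mpr fun _ _ => qFactorial_ne_zero_aux q hq _)

theorem starExpF_cocycle {d : ℕ} (K L M : Fin d → ℕ) :
    starExpF K L + starExpF (K + L) M = starExpF L M + starExpF K (L + M) := by
  simp only [starExpF, ← Finset.sum_add_distrib, Pi.add_apply]
  exact Finset.sum_congr rfl fun _ _ => by ring

theorem symCoeff_cocycle (q : ℂ) (hq : ∀ k, 1 ≤ k → qNat q k ≠ 0) {d : ℕ}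
    (K L M : Fin d →₀ ℕ) :
    symCoeff q K L * symCoeff q (K + L) M = symCoeff q L M * symCoeff q K (L + M) := by
  have hm : ∀ K : Fin d →₀ ℕ, (Nat.multinomial Finset.univ ⇑K : ℂ) ≠ 0 := fun K =>
    Nat.cast_ne_zero.mpr (Nat.multinomial_pos _ _).ne'
  have hb : ∀ K : Fin d →₀ ℕ, qMultinomial q ⇑K ≠ 0 := fun K => qMultinomial_ne_zero_aux q hq _
  have he : q ^ starExpF ⇑K ⇑L * q ^ starExpF ⇑(K + L) ⇑M
      = q ^ starExpF ⇑L ⇑M * q ^ starExpF ⇑K ⇑(L + M) := by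
    rw [← pow_add, ← pow_add]
    exact congrArg _ (starExpF_cocycle _ _ _)
  unfold symCoeff
  rw [← add_assoc K L M]
  have h1 := hm K
  have h2 := hm L
  have h3 := hm M
  have h4 := hm (K + L)
  have h5 := hm (L + M)
  have h6 := hm (K + L + M)
  have g1 := hb K
  have g2 := hb L
  have g3 := hb M
  have g4 := hb (K + L)
  have g5 := hb (L + M)
  have g6 := hb (K + L + M)
  generalize q ^ starExpF ⇑K ⇑L = a at *
  generalize q ^ starExpF ⇑(K + L) ⇑M = b at *
  generalize q ^ starExpF ⇑L ⇑M = c at *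
  generalize q ^ starExpF ⇑K ⇑(L + M) = e at *
  field_simp
  linear_combination he

/-- For `d ≥ 1` and `q ∈ ℂ` with `[k]_q ≠ 0` for all `k ≥ 1`, the symmetrized
combinatorial star product `⋆̃_q` (the unique bilinear map with
`x^K ⋆̃_q x^L = symCoeff q K L · x^{K+L}`) on `ℂ[x_1,…,x_d]` is associative. -/
theorem symmetrized_star_assoc {d : ℕ} (hd : 1 ≤ d) (q : ℂ)
    (hq : ∀ k, 1 ≤ k → qNat q k ≠ 0)
    (B : MvPolynomial (Fin d) ℂ →ₗ[ℂ] MvPolynomial (Fin d) ℂ →ₗ[ℂ] MvPolynomial (Fin d) ℂ)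
    (hB : ∀ K L : Fin d →₀ ℕ,
      B (monomial K 1) (monomial L 1) = symCoeff q K L • monomial (K + L) (1 : ℂ)) :
    ∀ f g h : MvPolynomial (Fin d) ℂ, B (B f g) h = B f (B g h) := by
  have hmon : ∀ K L M : Fin d →₀ ℕ, B (B (monomial K 1) (monomial L 1)) (monomial M 1)
      = B (monomial K 1) (B (monomial L 1) (monomial M 1)) := by
    intro K L M
    simp only [hB, map_smul, LinearMap.smul_apply, smul_smul]
    rw [symCoeff_cocycle q hq, add_assoc]
  have hs : ∀ (K : Fin d →₀ ℕ) (a : ℂ), monomial K a = a • monomial K (1 : ℂ) := by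
    intro K a
    simp [smul_monomial]
  intro f g h
  have ind : ∀ (P : MvPolynomial (Fin d) ℂ → Prop),
      (∀ K, P (monomial K 1)) → (∀ (a : ℂ) p, P p → P (a • p)) → (∀ p r, P p → P r → P (p + r)) →
      ∀ p, P p := by
    intro P h1 h2 h3 p
    induction p using MvPolynomial.induction_on' with
    | monomial K a => rw [hs]; exact h2 _ _ (h1 K)
    | add p r hp hr => exact h3 _ _ hp hr
  refine ind (fun f => B (B f g) h = B f (B g h)) (fun K => ?_) ?_ ?_ f
  · refine ind (fun g => B (B (monomial K 1) g) h = B (monomial K 1) (B g h)) (fun L => ?_) ?_ ?_ g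
    · refine ind (fun h => B (B (monomial K 1) (monomial L 1)) h
        = B (monomial K 1) (B (monomial L 1) h)) (fun M => hmon K L M) ?_ ?_ h
      · intro a p hp
        simp only [map_smul, hp]
      · intro p r hp hr
        simp only [map_add, hp, hr]
    · intro a p hp
      simp only [map_smul, LinearMap.smul_apply, hp]
    · intro p r hp hr
      simp only [map_add, LinearMap.add_apply, hp, hr]
  · intro a p hp
    simp only [map_smul, LinearMap.smul_apply, hp]
  · intro p r hp hr
    simp only [map_add, LinearMap.add_apply, hp, hr]
end

section
/- Let N ∈ ℕ, p, q, r ∈ ℂ with r ≠ 0, and let A be the quotient of the free algebra ℂ⟨x,y,z⟩ by the two-sided ideal generated by yx − rxy, zx − r⁻¹xz, and zy − qyz − (p−1)x^N. Then in A, for every m ≥ 1: z·y^m = q^m · y^m z + (p−1)·(Σ_{j=0}^{m−1} (q r^N)^j) · x^N y^{m−1}. -/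
/-- The defining relations of the algebra
`A = ℂ⟨x,y,z⟩ / (yx − rxy, zx − r⁻¹xz, zy − qyz − (p−1)x^N)`, where the generators of the
free algebra are `x = ι 0`, `y = ι 1`, `z = ι 2`. -/
inductive QRel (N : ℕ) (p q r : ℂ) :
    FreeAlgebra ℂ (Fin 3) → FreeAlgebra ℂ (Fin 3) → Prop
  | yx : QRel N p q r (FreeAlgebra.ι ℂ (1 : Fin 3) * FreeAlgebra.ι ℂ (0 : Fin 3))
      (r • (FreeAlgebra.ι ℂ (0 : Fin 3) * FreeAlgebra.ι ℂ (1 : Fin 3)))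
  | zx : QRel N p q r (FreeAlgebra.ι ℂ (2 : Fin 3) * FreeAlgebra.ι ℂ (0 : Fin 3))
      (r⁻¹ • (FreeAlgebra.ι ℂ (0 : Fin 3) * FreeAlgebra.ι ℂ (2 : Fin 3)))
  | zy : QRel N p q r (FreeAlgebra.ι ℂ (2 : Fin 3) * FreeAlgebra.ι ℂ (1 : Fin 3))
      (q • (FreeAlgebra.ι ℂ (1 : Fin 3) * FreeAlgebra.ι ℂ (2 : Fin 3))
        + (p - 1) • (FreeAlgebra.ι ℂ (0 : Fin 3)) ^ N)

/-- The quotient algebra `A`. -/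
abbrev QAlg (N : ℕ) (p q r : ℂ) := RingQuot (QRel N p q r)

/-- The image of the generator `x` in `A`. -/
noncomputable def Qx (N : ℕ) (p q r : ℂ) : QAlg N p q r :=
  RingQuot.mkAlgHom ℂ (QRel N p q r) (FreeAlgebra.ι ℂ (0 : Fin 3))

/-- The image of the generator `y` in `A`. -/
noncomputable def Qy (N : ℕ) (p q r : ℂ) : QAlg N p q r :=
  RingQuot.mkAlgHom ℂ (QRel N p q r) (FreeAlgebra.ι ℂ (1 : Fin 3))

/-- The image of the generator `z` in `A`. -/
noncomputable def Qz (N : ℕ) (p q r : ℂ) : QAlg N p q r :=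
  RingQuot.mkAlgHom ℂ (QRel N p q r) (FreeAlgebra.ι ℂ (2 : Fin 3))

theorem aux_yx {A : Type*} [Ring A] [Algebra ℂ A] (r : ℂ) (x y : A)
    (h : y * x = r • (x * y)) (N : ℕ) : y * x ^ N = r ^ N • (x ^ N * y) := by
  induction N with
  | zero => simp
  | succ n ih =>
    rw [pow_succ, ← mul_assoc, ih, smul_mul_assoc, mul_assoc, h, mul_smul_comm, smul_smul,
      ← mul_assoc, ← pow_succ]

theorem aux_yxm {A : Type*} [Ring A] [Algebra ℂ A] (s : ℂ) (u y : A)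
    (h : y * u = s • (u * y)) (m : ℕ) : y ^ m * u = s ^ m • (u * y ^ m) := by
  induction m with
  | zero => simp
  | succ n ih =>
    rw [pow_succ, mul_assoc, h, mul_smul_comm, ← mul_assoc, ih, smul_mul_assoc, smul_smul,
      mul_assoc, ← pow_succ, ← pow_succ']

theorem aux_main {A : Type*} [Ring A] [Algebra ℂ A] (s q c : ℂ) (u y z : A)
    (h : y * u = s • (u * y)) (hz : z * y = q • (y * z) + c • u) (n : ℕ) :
    z * y ^ (n + 1) = q ^ (n + 1) • (y ^ (n + 1) * z)
      + (c * ∑ j ∈ Finset.range (n + 1), (q * s) ^ j) • (u * y ^ n) := by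
  induction n with
  | zero => simp [hz]
  | succ n ih =>
    rw [pow_succ y (n + 1), ← mul_assoc, ih, Finset.sum_range_succ _ (n + 1), add_mul,
      smul_mul_assoc, mul_assoc (y ^ (n + 1)) z y, hz, mul_add, mul_smul_comm, mul_smul_comm,
      aux_yxm s u y h, smul_mul_assoc, mul_assoc u, ← pow_succ y n, ← mul_assoc]
    module

/-- In `A = ℂ⟨x,y,z⟩ / (yx − rxy, zx − r⁻¹xz, zy − qyz − (p−1)x^N)` with `r ≠ 0`, for every
`m ≥ 1` one has `z·y^m = q^m y^m z + (p−1)(Σ_{j=0}^{m−1} (q r^N)^j) x^N y^{m−1}`. -/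
theorem QAlg_z_mul_y_pow (N : ℕ) (p q r : ℂ) (hr : r ≠ 0) (m : ℕ) (hm : 1 ≤ m) :
    Qz N p q r * Qy N p q r ^ m
      = q ^ m • (Qy N p q r ^ m * Qz N p q r)
        + ((p - 1) * ∑ j ∈ Finset.range m, (q * r ^ N) ^ j) •
            (Qx N p q r ^ N * Qy N p q r ^ (m - 1)) := by
  obtain ⟨n, rfl⟩ : ∃ n, m = n + 1 := ⟨m - 1, by omega⟩
  have h1 : Qy N p q r * Qx N p q r = r • (Qx N p q r * Qy N p q r) := by
    have := RingQuot.mkAlgHom_rel ℂ (QRel.yx (N := N) (p := p) (q := q) (r := r))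
    simp only [map_mul, map_smul] at this
    exact this
  have h2 : Qz N p q r * Qy N p q r
      = q • (Qy N p q r * Qz N p q r) + (p - 1) • Qx N p q r ^ N := by
    have := RingQuot.mkAlgHom_rel ℂ (QRel.zy (N := N) (p := p) (q := q) (r := r))
    simp only [map_mul, map_smul, map_add, map_pow] at this
    exact this
  exact aux_main (r ^ N) q (p - 1) _ _ _ (aux_yx r _ _ h1 N) h2 n
end

section
/- Let N ∈ ℕ, p, q, r ∈ ℂ with r ≠ 0, and let A be the quotient of ℂ⟨x,y,z⟩ by the two-sided ideal generated by yx − rxy, zx − r⁻¹xz, and zy − qyz − (p−1)x^N. Then for all i, j, k, ℓ, m, n ∈ ℕ the following product formula holds in A: (x^i y^j z^k)·(x^ℓ y^m z^n) = Σ_{w ∈ {0,1}^k, |w| ≤ m} r^{(j−k)ℓ + jN|w|} · λ_m(w) · x^{i+ℓ+N|w|} y^{j+m−|w|} z^{k+n−|w|}, where r^{(j−k)ℓ} means r raised to the (possibly negative) integer (j−k)ℓ. -/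
/-- The weight `|w| = w_1 + ⋯ + w_k` of a word `w ∈ {0,1}^k`. -/
def wSum {k : ℕ} (w : Fin k → Fin 2) : ℕ := ∑ i, (w i).1

/-- The partial sum `s_{i−1} = w_1 + ⋯ + w_{i−1}` of the letters of `w` before position `i`. -/
def wPartial {k : ℕ} (w : Fin k → Fin 2) (i : Fin k) : ℕ :=
  ∑ j ∈ Finset.univ.filter (fun j : Fin k => j < i), (w j).1

/-- `λ̃_m(s, 0) = q^{m−s}` and `λ̃_m(s, 1) = (p−1) Σ_{j=0}^{m−s−1} (q r^N)^j`. -/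
noncomputable def lamTilde (N : ℕ) (p q r : ℂ) (m s : ℕ) (b : Fin 2) : ℂ :=
  if b = 0 then q ^ (m - s) else (p - 1) * ∑ j ∈ Finset.range (m - s), (q * r ^ N) ^ j

/-- `λ_m(w) = ∏_{i=1}^k r^{−N s_{i−1}} λ̃_m(s_{i−1}, w_i)`, with `λ_m(∅) = 1`. -/
noncomputable def lam (N : ℕ) (p q r : ℂ) (m : ℕ) {k : ℕ} (w : Fin k → Fin 2) : ℂ :=
  ∏ i : Fin k, r ^ (-((N * wPartial w i : ℕ) : ℤ)) * lamTilde N p q r m (wPartial w i) (w i)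

section Aux

variable (N : ℕ) (p q r : ℂ)

lemma Qyx : Qy N p q r * Qx N p q r = r • (Qx N p q r * Qy N p q r) := by
  have h := RingQuot.mkAlgHom_rel ℂ (QRel.yx (N := N) (p := p) (q := q) (r := r))
  simpa only [Qx, Qy, Qz, map_mul, map_smul] using h

lemma Qzx : Qz N p q r * Qx N p q r = r⁻¹ • (Qx N p q r * Qz N p q r) := by
  have h := RingQuot.mkAlgHom_rel ℂ (QRel.zx (N := N) (p := p) (q := q) (r := r))
  simpa only [Qx, Qy, Qz, map_mul, map_smul] using h

lemma Qzy : Qz N p q r * Qy N p q r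
    = q • (Qy N p q r * Qz N p q r) + (p - 1) • Qx N p q r ^ N := by
  have h := RingQuot.mkAlgHom_rel ℂ (QRel.zy (N := N) (p := p) (q := q) (r := r))
  simpa only [Qx, Qy, Qz, map_mul, map_smul, map_add, map_pow] using h

lemma comm_one {A : Type*} [Ring A] [Algebra ℂ A] (c : ℂ) (a x : A)
    (h : a * x = c • (x * a)) (l : ℕ) : a * x ^ l = c ^ l • (x ^ l * a) := by
  induction l with
  | zero => simp
  | succ l ih =>
    rw [pow_succ, ← mul_assoc, ih, smul_mul_assoc, mul_assoc, h, mul_smul_comm, smul_smul,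
      ← mul_assoc, pow_succ]

lemma comm_pow {A : Type*} [Ring A] [Algebra ℂ A] (c : ℂ) (a x : A)
    (h : a * x = c • (x * a)) (j l : ℕ) : a ^ j * x ^ l = c ^ (j * l) • (x ^ l * a ^ j) := by
  induction j with
  | zero => simp
  | succ j ih =>
    rw [pow_succ, mul_assoc, comm_one c a x h, mul_smul_comm, ← mul_assoc, ih, smul_mul_assoc,
      smul_smul, mul_assoc]
    congr 1
    ring

lemma Qz_ypow (t : ℕ) : Qz N p q r * Qy N p q r ^ t
    = q ^ t • (Qy N p q r ^ t * Qz N p q r)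
      + ((p - 1) * ∑ j ∈ Finset.range t, (q * r ^ N) ^ j) •
        (Qx N p q r ^ N * Qy N p q r ^ (t - 1)) := by
  induction t with
  | zero => simp
  | succ t ih =>
    have hy := comm_pow r _ _ (Qyx N p q r) t N
    have h2 : (((p - 1) * ∑ j ∈ Finset.range t, (q * r ^ N) ^ j) •
        (Qx N p q r ^ N * Qy N p q r ^ (t - 1))) * Qy N p q r
        = ((p - 1) * ∑ j ∈ Finset.range t, (q * r ^ N) ^ j) •
        (Qx N p q r ^ N * Qy N p q r ^ t) := by
      cases t with
      | zero => simp
      | succ t => rw [smul_mul_assoc, mul_assoc, Nat.add_sub_cancel, pow_succ]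
    rw [pow_succ, ← mul_assoc, ih, add_mul, h2, smul_mul_assoc, mul_assoc, Qzy, mul_add,
      mul_smul_comm, mul_smul_comm, hy, smul_add, smul_smul, smul_smul, smul_smul, ← mul_assoc,
      add_assoc, ← add_smul, Nat.add_sub_cancel, Finset.sum_range_succ]
    congr 2
    rw [mul_pow, ← pow_mul, mul_comm N t]
    ring

lemma wSum_snoc {k : ℕ} (w : Fin k → Fin 2) (b : Fin 2) :
    wSum (Fin.snoc (α := fun _ => Fin 2) w b : Fin (k + 1) → Fin 2) = wSum w + b.1 := by
  simp [wSum, Fin.sum_univ_castSucc]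

lemma wPartial_snoc_last {k : ℕ} (w : Fin k → Fin 2) (b : Fin 2) :
    wPartial (Fin.snoc (α := fun _ => Fin 2) w b : Fin (k + 1) → Fin 2) (Fin.last k)
      = wSum w := by
  simp [wPartial, wSum, Finset.sum_filter, Fin.sum_univ_castSucc, Fin.castSucc_lt_last]

lemma wPartial_snoc_castSucc {k : ℕ} (w : Fin k → Fin 2) (b : Fin 2) (i : Fin k) :
    wPartial (Fin.snoc (α := fun _ => Fin 2) w b : Fin (k + 1) → Fin 2) i.castSucc
      = wPartial w i := by
  have : ¬ Fin.last k < i.castSucc := not_lt.mpr (Fin.le_last _)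
  simp [wPartial, Finset.sum_filter, Fin.sum_univ_castSucc, this]

lemma lam_snoc (m : ℕ) {k : ℕ} (w : Fin k → Fin 2) (b : Fin 2) :
    lam N p q r m (Fin.snoc (α := fun _ => Fin 2) w b : Fin (k + 1) → Fin 2)
      = lam N p q r m w * (r ^ (-((N * wSum w : ℕ) : ℤ)) * lamTilde N p q r m (wSum w) b) := by
  unfold lam
  rw [Fin.prod_univ_castSucc]
  simp only [wPartial_snoc_last, wPartial_snoc_castSucc, Fin.snoc_castSucc, Fin.snoc_last]

lemma wSum_le {k : ℕ} (w : Fin k → Fin 2) : wSum w ≤ k := by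
  unfold wSum
  calc ∑ i, (w i).1 ≤ ∑ _i : Fin k, 1 := Finset.sum_le_sum fun i _ => by omega
    _ = k := by simp

lemma lam_zero (m : ℕ) {k : ℕ} (w : Fin k → Fin 2) (h : m < wSum w) : lam N p q r m w = 0 := by
  induction k with
  | zero => simp [wSum] at h
  | succ k ih =>
    obtain ⟨v, b, rfl⟩ : ∃ (v : Fin k → Fin 2) (b : Fin 2),
        w = (Fin.snoc (α := fun _ => Fin 2) v b : Fin (k + 1) → Fin 2) :=
      ⟨fun i => w i.castSucc, w (Fin.last k), (Fin.snoc_init_self (α := fun _ => Fin 2) w).symm⟩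
    rw [lam_snoc]
    rw [wSum_snoc] at h
    by_cases hv : m < wSum v
    · rw [ih v hv, zero_mul]
    · have hb : b ≠ 0 := by
        rintro rfl
        simp at h
        omega
      have : m - wSum v = 0 := by omega
      simp [lamTilde, hb, this]

lemma Qz_mono (hr : r ≠ 0) (m s c : ℕ) :
    Qz N p q r * (Qx N p q r ^ (N * s) * Qy N p q r ^ (m - s) * Qz N p q r ^ c)
    = (r ^ (-((N * s : ℕ) : ℤ)) * lamTilde N p q r m s 0) •
        (Qx N p q r ^ (N * s) * Qy N p q r ^ (m - s) * Qz N p q r ^ (c + 1))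
      + (r ^ (-((N * s : ℕ) : ℤ)) * lamTilde N p q r m s 1) •
        (Qx N p q r ^ (N * (s + 1)) * Qy N p q r ^ (m - (s + 1)) * Qz N p q r ^ c) := by
  have h0 : r ^ (-((N * s : ℕ) : ℤ)) = r⁻¹ ^ (N * s) := by
    rw [zpow_neg, zpow_natCast, inv_pow]
  rw [h0, ← mul_assoc, ← mul_assoc, comm_one r⁻¹ _ _ (Qzx N p q r), smul_mul_assoc,
    mul_assoc (Qx N p q r ^ (N * s)), Qz_ypow]
  simp only [lamTilde, if_true, if_neg (one_ne_zero : (1 : Fin 2) ≠ 0), mul_add, add_mul, smul_add,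
    smul_mul_assoc, mul_smul_comm, smul_smul, mul_assoc, mul_one, pow_add, pow_one, Nat.sub_sub,
    pow_succ']

lemma Qzy_pow (hr : r ≠ 0) (k m : ℕ) : Qz N p q r ^ k * Qy N p q r ^ m
    = ∑ w : Fin k → Fin 2, lam N p q r m w •
        (Qx N p q r ^ (N * wSum w) * Qy N p q r ^ (m - wSum w) * Qz N p q r ^ (k - wSum w)) := by
  induction k with
  | zero => simp [lam, wSum]
  | succ k ih =>
    rw [pow_succ', mul_assoc, ih, Finset.mul_sum,
      ← (Fin.snocEquiv (fun _ : Fin (k + 1) => Fin 2)).sum_comp, Fintype.sum_prod_type,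
      Fin.sum_univ_two, ← Finset.sum_add_distrib]
    refine Finset.sum_congr rfl fun w _ => ?_
    have e : ∀ b : Fin 2, (Fin.snocEquiv (fun _ : Fin (k + 1) => Fin 2)) (b, w)
      = (Fin.snoc (α := fun _ => Fin 2) w b : Fin (k + 1) → Fin 2) := fun b => rfl
    have hk := wSum_le w
    rw [mul_smul_comm, Qz_mono N p q r hr, smul_add, smul_smul, smul_smul, e, e, lam_snoc, lam_snoc,
      wSum_snoc, wSum_snoc]
    have h1 : k + 1 - (wSum w + 1) = k - wSum w := by omega
    have h2 : k - wSum w + 1 = k + 1 - wSum w := by omega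
    simp [h1, h2]

end Aux

/-- The product formula in `A = ℂ⟨x,y,z⟩ / (yx − rxy, zx − r⁻¹xz, zy − qyz − (p−1)x^N)`
with `r ≠ 0`: for all `i, j, k, ℓ, m, n ∈ ℕ`,
`(x^i y^j z^k)(x^ℓ y^m z^n) = Σ_{w ∈ {0,1}^k, |w| ≤ m} r^{(j−k)ℓ + jN|w|} λ_m(w)
x^{i+ℓ+N|w|} y^{j+m−|w|} z^{k+n−|w|}`. -/
theorem QAlg_product_formula (N : ℕ) (p q r : ℂ) (hr : r ≠ 0)
    (i j k ℓ m n : ℕ) :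
    (Qx N p q r ^ i * Qy N p q r ^ j * Qz N p q r ^ k)
        * (Qx N p q r ^ ℓ * Qy N p q r ^ m * Qz N p q r ^ n)
      = ∑ w ∈ Finset.univ.filter (fun w : Fin k → Fin 2 => wSum w ≤ m),
          (r ^ (((j : ℤ) - (k : ℤ)) * (ℓ : ℤ) + (j : ℤ) * (N : ℤ) * (wSum w : ℤ))
              * lam N p q r m w) •
            (Qx N p q r ^ (i + ℓ + N * wSum w) * Qy N p q r ^ (j + m - wSum w)
              * Qz N p q r ^ (k + n - wSum w)) := by
  have hx := comm_pow r⁻¹ _ _ (Qzx N p q r) k ℓ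
  have e1 : (Qx N p q r ^ i * Qy N p q r ^ j * Qz N p q r ^ k)
        * (Qx N p q r ^ ℓ * Qy N p q r ^ m * Qz N p q r ^ n)
      = (r ^ (((j : ℤ) - (k : ℤ)) * (ℓ : ℤ))) • (Qx N p q r ^ (i + ℓ) * (Qy N p q r ^ j *
        (Qz N p q r ^ k * Qy N p q r ^ m) * Qz N p q r ^ n)) := by
    have hc : r ^ (((j : ℤ) - (k : ℤ)) * (ℓ : ℤ)) = r⁻¹ ^ (k * ℓ) * r ^ (j * ℓ) := by
      rw [sub_mul, zpow_sub₀ hr, inv_pow, ← zpow_natCast, ← zpow_natCast]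
      push_cast
      rw [div_eq_mul_inv, mul_comm]
    calc _ = Qx N p q r ^ i * (Qy N p q r ^ j * ((Qz N p q r ^ k * Qx N p q r ^ ℓ)
            * (Qy N p q r ^ m * Qz N p q r ^ n))) := by simp only [mul_assoc]
      _ = r⁻¹ ^ (k * ℓ) • (Qx N p q r ^ i * ((Qy N p q r ^ j * Qx N p q r ^ ℓ) * (Qz N p q r ^ k
            * (Qy N p q r ^ m * Qz N p q r ^ n)))) := by
          rw [hx]; simp only [mul_assoc, smul_mul_assoc, mul_smul_comm]
      _ = _ := by
          rw [comm_pow r _ _ (Qyx N p q r) j ℓ, hc]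
          simp only [mul_assoc, smul_mul_assoc, mul_smul_comm, smul_smul, pow_add]
  rw [e1, Qzy_pow N p q r hr, Finset.mul_sum, Finset.sum_mul, Finset.mul_sum, Finset.smul_sum]
  rw [Finset.sum_filter]
  refine Finset.sum_congr rfl fun w _ => ?_
  split_ifs with hw
  · have hk := wSum_le w
    have a1 : j + m - wSum w = j + (m - wSum w) := by omega
    have a2 : k + n - wSum w = (k - wSum w) + n := by omega
    have hy := comm_pow r _ _ (Qyx N p q r) j (N * wSum w)
    have hc : r ^ (((j : ℤ) - (k : ℤ)) * (ℓ : ℤ) + (j : ℤ) * (N : ℤ) * (wSum w : ℤ))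
        = r ^ (((j : ℤ) - (k : ℤ)) * (ℓ : ℤ)) * r ^ (j * (N * wSum w)) := by
      rw [zpow_add₀ hr, ← zpow_natCast r (j * (N * wSum w))]
      push_cast
      rw [mul_assoc (j : ℤ)]
    have hy2 : Qy N p q r ^ j * (Qx N p q r ^ (N * wSum w) * Qy N p q r ^ (m - wSum w)
          * Qz N p q r ^ (k - wSum w))
        = r ^ (j * (N * wSum w)) • (Qx N p q r ^ (N * wSum w) * (Qy N p q r ^ j *
          (Qy N p q r ^ (m - wSum w) * Qz N p q r ^ (k - wSum w)))) := by
      rw [← mul_assoc, ← mul_assoc, hy]; simp only [mul_assoc, smul_mul_assoc]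
    rw [a1, a2, hc, mul_smul_comm, hy2, pow_add _ (i + ℓ), pow_add _ j, pow_add _ (k - wSum w)]
    simp only [mul_assoc, smul_mul_assoc, mul_smul_comm, smul_smul]
    congr 1
    ring
  · rw [lam_zero N p q r m w (by omega)]
    simp
end
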